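/- Let X be a reflexive real Banach space. If the pair (X, ℓ∞) has the compact perturbation property, then X is finite-dimensional. -/

import Mathlib

open Filter Topology
open scoped ENNReal

/-- A bounded linear operator attains its norm if `‖T x‖ = ‖T‖` for some `x` in the
closed unit ball. -/
def NormAttains {X Y : Type*} [NormedAddCommGroup X] [NormedSpace ℝ X]
    [NormedAddCommGroup Y] [NormedSpace ℝ Y] (T : X →L[ℝ] Y) : Prop :=
  ∃ x : X, ‖x‖ ≤ 1 ∧ ‖T x‖ = ‖T‖

/-- The pair `(X, Y)` has the compact perturbation property. -/
def CPP (X Y : Type*) [NormedAddCommGroup X] [NormedSpace ℝ X]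
    [NormedAddCommGroup Y] [NormedSpace ℝ Y] : Prop :=
  ∀ T K : X →L[ℝ] Y, IsCompactOperator ⇑K → ‖T‖ < ‖T + K‖ → NormAttains (T + K)

/-- A normed space is reflexive if the canonical embedding into the bidual is surjective. -/
def IsReflexiveSpace (X : Type*) [NormedAddCommGroup X] [NormedSpace ℝ X] : Prop :=
  Function.Surjective (NormedSpace.inclusionInDoubleDual ℝ X)

theorem exists_ultrafilter_limit {E : Type*} [NormedAddCommGroup E] [NormedSpace ℝ E]
    (f : ℕ → StrongDual ℝ E) {C : ℝ} (hf : ∀ n, ‖f n‖ ≤ C) (U : Ultrafilter ℕ) :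
    ∃ g : StrongDual ℝ E, ∀ x, Tendsto (fun n => f n x) U (𝓝 (g x)) := by
  have hc := WeakDual.isCompact_closedBall (𝕜 := ℝ) (E := E) 0 C
  obtain ⟨g, -, hg⟩ := hc.ultrafilter_le_nhds (U.map fun n => StrongDual.toWeakDual (f n)) (by
    rw [le_principal_iff]
    exact mem_map.2 (univ_mem' fun n => by simpa using hf n))
  refine ⟨WeakDual.toStrongDual g, fun x => ?_⟩
  exact ((WeakDual.eval_continuous x).tendsto g).comp hg

theorem IsReflexiveSpace.exists_ultrafilter_limit {X : Type*} [NormedAddCommGroup X]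
    [NormedSpace ℝ X] (hX : IsReflexiveSpace X) (x : ℕ → X) {C : ℝ} (hx : ∀ n, ‖x n‖ ≤ C)
    (U : Ultrafilter ℕ) :
    ∃ a : X, ∀ f : StrongDual ℝ X, Tendsto (fun n => f (x n)) U (𝓝 (f a)) := by
  obtain ⟨g, hg⟩ := _root_.exists_ultrafilter_limit
    (fun n => NormedSpace.inclusionInDoubleDual ℝ X (x n)) (C := C)
    (fun n => (NormedSpace.double_dual_bound ℝ X (x n)).trans (hx n)) U
  obtain ⟨a, rfl⟩ := hX g
  exact ⟨a, fun f => by simpa using hg f⟩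

/-- Every functional on a reflexive space attains its norm. -/
theorem IsReflexiveSpace.exists_apply_eq_norm {X : Type*} [NormedAddCommGroup X]
    [NormedSpace ℝ X] (hX : IsReflexiveSpace X) (f : StrongDual ℝ X) :
    ∃ x : X, ‖x‖ ≤ 1 ∧ f x = ‖f‖ := by
  obtain ⟨g, hg, hgf⟩ := exists_dual_vector'' ℝ f
  obtain ⟨x, rfl⟩ := hX g
  refine ⟨x, ?_, by simpa using hgf⟩
  rw [← (NormedSpace.inclusionInDoubleDualLi ℝ).norm_map x]
  exact hg

theorem finiteDimensional_of_finiteDimensional_strongDual {X : Type*} [NormedAddCommGroup X]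
    [NormedSpace ℝ X] (h : FiniteDimensional ℝ (StrongDual ℝ X)) : FiniteDimensional ℝ X := by
  have : FiniteDimensional ℝ (StrongDual ℝ (StrongDual ℝ X)) :=
    Module.Finite.of_injective
      (ContinuousLinearMap.coeLM ℝ : _ →ₗ[ℝ] (StrongDual ℝ X →ₗ[ℝ] ℝ))
      ContinuousLinearMap.coe_injective
  exact Module.Finite.of_injective
    (NormedSpace.inclusionInDoubleDualLi ℝ (E := X)).toLinearMap
    (NormedSpace.inclusionInDoubleDualLi ℝ (E := X)).injective

theorem exists_isSeparable_submodule_not_finiteDimensional {E : Type*} [NormedAddCommGroup E]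
    [NormedSpace ℝ E] (hE : ¬ FiniteDimensional ℝ E) :
    ∃ W : Submodule ℝ E, TopologicalSpace.IsSeparable (W : Set E) ∧ ¬ FiniteDimensional ℝ W := by
  let b := Module.Basis.ofVectorSpace ℝ E
  have hinf : Infinite (Module.Basis.ofVectorSpaceIndex ℝ E) := by
    by_contra h
    rw [not_infinite_iff_finite] at h
    exact hE (Module.Finite.of_basis b)
  let v : ℕ → E := b ∘ Infinite.natEmbedding _
  have hv : LinearIndependent ℝ v :=
    b.linearIndependent.comp _ (Infinite.natEmbedding _).injective
  refine ⟨Submodule.span ℝ (Set.range v),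
    (Set.countable_range v).isSeparable.span (R := ℝ), fun hfin => ?_⟩
  have := (linearIndependent_span hv).finite
  exact not_finite ℕ

theorem exists_norm_eq_one_forall_lt_apply_eq_zero {E : Type*} [NormedAddCommGroup E]
    [NormedSpace ℝ E] {W : Submodule ℝ E} (hW : ¬ FiniteDimensional ℝ W)
    (φ : ℕ → StrongDual ℝ E) (n : ℕ) : ∃ e ∈ W, ‖e‖ = 1 ∧ ∀ i < n, φ i e = 0 := by
  let L : W →ₗ[ℝ] (Fin n → ℝ) :=
    LinearMap.pi fun i => (φ i : E →ₗ[ℝ] ℝ) ∘ₗ W.subtype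
  have hL : ¬ Function.Injective L := fun h => hW (Module.Finite.of_injective L h)
  have hker : L.ker ≠ ⊥ := fun h => hL (LinearMap.ker_eq_bot.1 h)
  obtain ⟨w, hw, hw0⟩ := (Submodule.ne_bot_iff _).1 hker
  have hw0' : (w : E) ≠ 0 := by simpa using hw0
  refine ⟨(‖(w : E)‖⁻¹ : ℝ) • (w : E), W.smul_mem _ w.2, ?_, ?_⟩
  · rw [norm_smul, norm_inv, norm_norm, inv_mul_cancel₀ (norm_ne_zero_iff.2 hw0')]
  · intro i hi
    have : φ i (w : E) = 0 := congrFun (LinearMap.mem_ker.1 hw) ⟨i, hi⟩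
    rw [map_smul, this, smul_zero]

theorem exists_seq_separating_topologicalClosure {X : Type*} [NormedAddCommGroup X]
    [NormedSpace ℝ X] (hX : IsReflexiveSpace X) {W : Submodule ℝ (StrongDual ℝ X)}
    (hW : TopologicalSpace.IsSeparable (W : Set (StrongDual ℝ X))) :
    ∃ x : ℕ → X, ∀ y ∈ W.topologicalClosure, (∀ i, y (x i) = 0) → y = 0 := by
  obtain ⟨c, hc, hWc⟩ := hW
  have : (W : Set (StrongDual ℝ X)).Nonempty := W.nonempty
  have hne : c.Nonempty := closure_nonempty_iff.1 (this.mono hWc)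
  obtain ⟨d, rfl⟩ := hc.exists_eq_range hne
  choose x hx1 hx using fun i => hX.exists_apply_eq_norm (d i)
  refine ⟨x, fun y hy h0 => ?_⟩
  have hy' : y ∈ closure (Set.range d) := closure_minimal hWc isClosed_closure hy
  rw [← norm_le_zero_iff]
  refine le_of_forall_pos_le_add fun ε hε => ?_
  obtain ⟨_, ⟨i, rfl⟩, hi⟩ := Metric.mem_closure_iff.1 hy' (ε / 2) (by positivity)
  rw [dist_eq_norm] at hi
  have h1 : ‖d i‖ ≤ ‖y - d i‖ := by
    have := (y - d i).le_of_opNorm_le le_rfl (x i)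
    rw [_root_.sub_apply, h0, hx, zero_sub, norm_neg, norm_norm] at this
    nlinarith [norm_nonneg (y - d i), hx1 i]
  have h2 : ‖y‖ ≤ ‖y - d i‖ + ‖d i‖ := by simpa using norm_add_le (y - d i) (d i)
  linarith

theorem IsReflexiveSpace.mem_topologicalClosure_of_tendsto {X : Type*} [NormedAddCommGroup X]
    [NormedSpace ℝ X] (hX : IsReflexiveSpace X) {W : Submodule ℝ (StrongDual ℝ X)}
    {e : ℕ → StrongDual ℝ X} (he : ∀ n, e n ∈ W) {l : Filter ℕ} [l.NeBot] {y : StrongDual ℝ X}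
    (hy : ∀ x, Tendsto (fun n => e n x) l (𝓝 (y x))) : y ∈ W.topologicalClosure := by
  by_contra hyW
  obtain ⟨φ, u, hφy, hφ⟩ := geometric_hahn_banach_point_closed
    (W.topologicalClosure.convex) W.isClosed_topologicalClosure hyW
  obtain ⟨x, rfl⟩ := hX φ
  exact absurd (ge_of_tendsto' (hy x) fun n => (hφ (e n) (subset_closure (he n))).le)
    (not_le.2 hφy)

/-- The dual of an infinite-dimensional reflexive space contains a normalized sequence which
converges pointwise to zero. -/
theorem IsReflexiveSpace.exists_normalized_tendsto_zero {X : Type*} [NormedAddCommGroup X]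
    [NormedSpace ℝ X] (hX : IsReflexiveSpace X) (hfin : ¬ FiniteDimensional ℝ X) :
    ∃ e : ℕ → StrongDual ℝ X, (∀ n, ‖e n‖ = 1) ∧
      ∀ x, Tendsto (fun n => e n x) atTop (𝓝 0) := by
  obtain ⟨W, hWs, hWf⟩ := exists_isSeparable_submodule_not_finiteDimensional
    (fun h => hfin (finiteDimensional_of_finiteDimensional_strongDual (X := X) h))
  obtain ⟨x, hx⟩ := exists_seq_separating_topologicalClosure hX hWs
  choose e heW he1 he0 using exists_norm_eq_one_forall_lt_apply_eq_zero hWf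
    fun n => NormedSpace.inclusionInDoubleDual ℝ X (x n)
  refine ⟨e, he1, fun z => tendsto_iff_ultrafilter _ _ _ |>.2 fun U hU => ?_⟩
  obtain ⟨y, hy⟩ := _root_.exists_ultrafilter_limit e (fun n => (he1 n).le) U
  have hy0 : y = 0 := by
    refine hx y (hX.mem_topologicalClosure_of_tendsto heW hy) fun i => ?_
    refine tendsto_nhds_unique (hy (x i)) (Tendsto.congr' ?_ tendsto_const_nhds)
    exact hU ((eventually_gt_atTop i).mono fun n hn => (he0 n i hn).symm)
  simpa [hy0] using hy z

/-- A bounded sequence of functionals, viewed as an operator into `ℓ∞`. -/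
noncomputable def operatorOfRows {X : Type*} [NormedAddCommGroup X] [NormedSpace ℝ X]
    (f : ℕ → StrongDual ℝ X) (C : ℝ) (hC : 0 ≤ C) (hf : ∀ n, ‖f n‖ ≤ C) :
    X →L[ℝ] lp (fun _ : ℕ => ℝ) ∞ :=
  LinearMap.mkContinuous
    { toFun := fun x => ⟨fun n => f n x, memℓp_infty ⟨C * ‖x‖, by
        rintro _ ⟨n, rfl⟩
        exact (f n).le_of_opNorm_le (hf n) x⟩⟩
      map_add' := fun u v => by
        ext n
        exact (f n).map_add u v
      map_smul' := fun r u => by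
        ext n
        exact (f n).map_smul r u } C fun x =>
    lp.norm_le_of_forall_le (by positivity) fun n => (f n).le_of_opNorm_le (hf n) x

@[simp]
theorem operatorOfRows_apply {X : Type*} [NormedAddCommGroup X] [NormedSpace ℝ X]
    (f : ℕ → StrongDual ℝ X) (C : ℝ) (hC : 0 ≤ C) (hf : ∀ n, ‖f n‖ ≤ C) (x : X) (n : ℕ) :
    operatorOfRows f C hC hf x n = f n x := rfl

theorem norm_operatorOfRows_le {X : Type*} [NormedAddCommGroup X] [NormedSpace ℝ X]
    (f : ℕ → StrongDual ℝ X) (C : ℝ) (hC : 0 ≤ C) (hf : ∀ n, ‖f n‖ ≤ C) :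
    ‖operatorOfRows f C hC hf‖ ≤ C :=
  LinearMap.mkContinuous_norm_le _ hC _

theorem norm_le_norm_operatorOfRows {X : Type*} [NormedAddCommGroup X] [NormedSpace ℝ X]
    (f : ℕ → StrongDual ℝ X) (C : ℝ) (hC : 0 ≤ C) (hf : ∀ n, ‖f n‖ ≤ C) (n : ℕ) :
    ‖f n‖ ≤ ‖operatorOfRows f C hC hf‖ :=
  ContinuousLinearMap.opNorm_le_bound _ (norm_nonneg _) fun x =>
    (lp.norm_apply_le_norm ENNReal.top_ne_zero (operatorOfRows f C hC hf x) n).trans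
      ((operatorOfRows f C hC hf).le_opNorm x)

theorem isCompactOperator_operatorOfRows_smul {X : Type*} [NormedAddCommGroup X]
    [NormedSpace ℝ X] (g : StrongDual ℝ X) (c : ℕ → ℝ) (C : ℝ) (hC : 0 ≤ C)
    (hf : ∀ n, ‖c n • g‖ ≤ C) :
    IsCompactOperator (operatorOfRows (fun n => c n • g) C hC hf) := by
  by_cases hg : g = 0
  · convert isCompactOperator_zero (M₁ := X) (M₂ := lp (fun _ : ℕ => ℝ) ∞)
    ext x n
    simp [hg]
  · obtain ⟨z, hz⟩ : ∃ z, g z ≠ 0 := by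
      by_contra! h
      exact hg (ContinuousLinearMap.ext h)
    have hK : (operatorOfRows (fun n => c n • g) C hC hf : X → lp (fun _ : ℕ => ℝ) ∞) =
        (ContinuousLinearMap.toSpanSingleton ℝ
          ((g z)⁻¹ • operatorOfRows (fun n => c n • g) C hC hf z)) ∘ g := by
      ext x n
      simp
      field_simp
    rw [hK]
    exact (isCompactOperator_id (E := ℝ)).comp_clm g |>.clm_comp _

theorem CPP.eventually_norm_add_lt {X : Type*} [NormedAddCommGroup X] [NormedSpace ℝ X]
    (hX : CPP X (lp (fun _ : ℕ => ℝ) ∞)) {e : ℕ → StrongDual ℝ X} (he1 : ∀ n, ‖e n‖ ≤ 1)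
    (he0 : ∀ x, Tendsto (fun n => e n x) atTop (𝓝 0)) {g : StrongDual ℝ X} {M : ℝ}
    (hg : ‖g‖ < M) (hM : 1 < M) : ∀ᶠ n in atTop, ‖g + e n‖ < M := by
  by_contra h
  obtain ⟨φ, hφ, hφM⟩ := extraction_of_frequently_atTop (not_eventually.1 h)
  simp only [not_lt] at hφM
  let a : ℕ → ℝ := fun n => 1 - 1 / ((n : ℝ) + 1)
  have ha_lt : ∀ n, a n < 1 := fun n => sub_lt_self _ (by positivity)
  have ha_nonneg : ∀ n, 0 ≤ a n := fun n => by
    have : 1 / ((n : ℝ) + 1) ≤ 1 := by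
      rw [div_le_one (by positivity)]
      linarith [(n.cast_nonneg : (0 : ℝ) ≤ n)]
    simpa [a] using this
  have ha_mono : Monotone a := fun m n hmn =>
    sub_le_sub_left (one_div_le_one_div_of_le (by positivity) (by gcongr)) 1
  have ha_tendsto : Tendsto a atTop (𝓝 1) := by
    simpa [a] using (tendsto_const_nhds (x := (1 : ℝ))).sub
      (tendsto_one_div_add_atTop_nhds_zero_nat (𝕜 := ℝ))
  let c : ℕ → ℝ := fun n => a n * M / ‖g + e (φ n)‖
  have hpos : ∀ n, 0 < ‖g + e (φ n)‖ := fun n => by linarith [hφM n]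
  have hc0 : ∀ n, 0 ≤ c n := fun n =>
    div_nonneg (mul_nonneg (ha_nonneg n) (by linarith)) (hpos n).le
  have hc1 : ∀ n, c n ≤ 1 := fun n => by
    rw [div_le_one (hpos n)]
    nlinarith [hφM n, ha_lt n]
  have hc_smul : ∀ n (f : StrongDual ℝ X), ‖c n • f‖ ≤ ‖f‖ := fun n f => by
    rw [norm_smul, Real.norm_of_nonneg (hc0 n)]
    exact mul_le_of_le_one_left (norm_nonneg f) (hc1 n)
  have hf : ∀ n, ‖c n • (g + e (φ n))‖ = a n * M := fun n => by
    rw [norm_smul, Real.norm_of_nonneg (hc0 n), div_mul_cancel₀ _ (hpos n).ne']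
  have hfM : ∀ n, ‖c n • (g + e (φ n))‖ ≤ M := fun n => by
    rw [hf]
    nlinarith [ha_lt n]
  let T := operatorOfRows (fun n => c n • e (φ n)) 1 zero_le_one
    fun n => (hc_smul n _).trans (he1 _)
  let K := operatorOfRows (fun n => c n • g) ‖g‖ (norm_nonneg g) fun n => hc_smul n g
  let S := operatorOfRows (fun n => c n • (g + e (φ n))) M (by linarith) hfM
  have hTK : T + K = S := by
    ext x n
    simp [T, K, S]
    ring
  have hS : ‖S‖ = M := by
    refine le_antisymm (norm_operatorOfRows_le _ _ _ _) ?_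
    refine le_of_tendsto' (by simpa using ha_tendsto.mul_const M) fun n => ?_
    rw [← hf n]
    exact norm_le_norm_operatorOfRows _ _ _ hfM n
  obtain ⟨x, hx, hxS⟩ := hX T K (isCompactOperator_operatorOfRows_smul _ _ _ _ _) (by
    rw [hTK, hS]
    exact (norm_operatorOfRows_le _ _ _ _).trans_lt hM)
  rw [hTK, hS] at hxS
  have hsmall : ∀ᶠ n in atTop, |e (φ n) x| < (M - ‖g‖) / 2 := by
    have := ((he0 x).comp hφ.tendsto_atTop).abs
    rw [abs_zero] at this
    exact this.eventually_lt_const (by linarith)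
  obtain ⟨N, hN⟩ := eventually_atTop.1 hsmall
  have hB : ‖S x‖ ≤ max ((M + ‖g‖) / 2) (a N * M) := by
    refine lp.norm_le_of_forall_le
      (le_max_of_le_left (by linarith [norm_nonneg g])) fun n => ?_
    rcases le_total N n with hn | hn
    · refine le_max_of_le_left ?_
      have h1 : |g x| ≤ ‖g‖ := g.unit_le_opNorm x hx
      have h2 := hN n hn
      calc ‖S x n‖ = c n * |g x + e (φ n) x| := by
            simp [S, ← mul_add, abs_of_nonneg (hc0 n)]
        _ ≤ |g x + e (φ n) x| := mul_le_of_le_one_left (abs_nonneg _) (hc1 n)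
        _ ≤ |g x| + |e (φ n) x| := abs_add_le _ _
        _ ≤ (M + ‖g‖) / 2 := by linarith
    · refine le_max_of_le_right ?_
      calc ‖S x n‖ ≤ ‖c n • (g + e (φ n))‖ :=
            (c n • (g + e (φ n))).unit_le_opNorm x hx
        _ = a n * M := hf n
        _ ≤ a N * M := mul_le_mul_of_nonneg_right (ha_mono hn) (by linarith)
  rw [hxS] at hB
  refine absurd hB (not_le.2 (max_lt (by linarith) ?_))
  nlinarith [ha_lt N]

theorem exists_seq_norm_sign_sum_lt {E : Type*} [NormedAddCommGroup E] [NormedSpace ℝ E]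
    {S : Set E} {M : ℝ} (hM : 0 < M)
    (h : ∀ G : Finset E, (∀ g ∈ G, ‖g‖ < M) → ∃ y ∈ S, ∀ g ∈ G, ‖g + y‖ < M ∧ ‖g - y‖ < M) :
    ∃ y : ℕ → E, (∀ n, y n ∈ S) ∧ ∀ ε : ℕ → ℝ, (∀ i, ε i = 1 ∨ ε i = -1) →
      ∀ n, ‖∑ i ∈ Finset.range n, ε i • y i‖ < M := by
  classical
  choose! next hnextS hnext using h
  let step : Finset E → Finset E := fun G => G.image (· + next G) ∪ G.image (· - next G)
  let G : ℕ → Finset E := fun n => step^[n] {0}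
  have hGsucc : ∀ n, G (n + 1) = step (G n) := fun n => Function.iterate_succ_apply' _ _ _
  have hG : ∀ n, ∀ g ∈ G n, ‖g‖ < M := by
    intro n
    induction n with
    | zero => simpa [G] using hM
    | succ n ih =>
      intro g hg
      rw [hGsucc] at hg
      rcases Finset.mem_union.1 hg with hg | hg
      · obtain ⟨g', hg', rfl⟩ := Finset.mem_image.1 hg
        exact (hnext _ ih g' hg').1
      · obtain ⟨g', hg', rfl⟩ := Finset.mem_image.1 hg
        exact (hnext _ ih g' hg').2
  refine ⟨fun n => next (G n), fun n => hnextS _ (hG n), fun ε hε n => hG n _ ?_⟩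
  induction n with
  | zero => simp [G]
  | succ n ih =>
    rw [Finset.sum_range_succ, hGsucc]
    refine Finset.mem_union.2 ((hε n).imp (fun h => ?_) fun h => ?_)
    · exact Finset.mem_image.2 ⟨_, ih, by simp [h]⟩
    · exact Finset.mem_image.2 ⟨_, ih, by simp [h, sub_eq_add_neg]⟩

theorem sum_abs_apply_le {X : Type*} [NormedAddCommGroup X] [NormedSpace ℝ X]
    {e : ℕ → StrongDual ℝ X} {M : ℝ} (he : ∀ ε : ℕ → ℝ, (∀ i, ε i = 1 ∨ ε i = -1) →
      ∀ n, ‖∑ i ∈ Finset.range n, ε i • e i‖ < M) (x : X) (n : ℕ) :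
    ∑ i ∈ Finset.range n, |e i x| ≤ M * ‖x‖ := by
  let ε : ℕ → ℝ := fun i => if 0 ≤ e i x then 1 else -1
  have hε : ∀ i, ε i = 1 ∨ ε i = -1 := fun i => by
    simp only [ε]
    split_ifs <;> simp
  have hεe : ∀ i, ε i * e i x = |e i x| := fun i => by
    simp only [ε]
    split_ifs with h
    · rw [abs_of_nonneg h, one_mul]
    · rw [abs_of_neg (not_le.1 h), neg_one_mul]
  calc ∑ i ∈ Finset.range n, |e i x| = (∑ i ∈ Finset.range n, ε i • e i) x := by
        simp [hεe]
    _ ≤ ‖(∑ i ∈ Finset.range n, ε i • e i) x‖ := Real.le_norm_self _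
    _ ≤ M * ‖x‖ := ContinuousLinearMap.le_of_opNorm_le _ (he ε hε n).le x

theorem exists_strongDual_apply_eq_tsum {X : Type*} [NormedAddCommGroup X] [NormedSpace ℝ X]
    {e : ℕ → StrongDual ℝ X} {M : ℝ}
    (hsum : ∀ x n, ∑ i ∈ Finset.range n, |e i x| ≤ M * ‖x‖) :
    ∃ y : StrongDual ℝ X, ∀ x, y x = ∑' i, e i x := by
  have hsummable_abs : ∀ x, Summable fun i => |e i x| := fun x =>
    summable_of_sum_range_le (fun _ => abs_nonneg _) (hsum x)
  have hsummable : ∀ x, Summable fun i => e i x := fun x => (hsummable_abs x).of_abs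
  let L : X →ₗ[ℝ] ℝ :=
    { toFun := fun x => ∑' i, e i x
      map_add' := fun u v => by
        rw [← (hsummable u).tsum_add (hsummable v)]
        exact tsum_congr fun i => (e i).map_add u v
      map_smul' := fun r u => by
        rw [RingHom.id_apply, smul_eq_mul, ← tsum_mul_left]
        exact tsum_congr fun i => (e i).map_smul r u }
  refine ⟨L.mkContinuous M fun x => ?_, fun x => rfl⟩
  have hnorm : ‖∑' i, e i x‖ ≤ ∑' i, |e i x| :=
    norm_tsum_le_tsum_norm (f := fun i => e i x) (hsummable_abs x)
  exact hnorm.trans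
    (Real.tsum_le_of_sum_range_le (fun _ => abs_nonneg _) (hsum x))

/-- A reflexive space has no normalized sequence of functionals whose sums with arbitrary signs
are bounded by a constant smaller than two. -/
theorem IsReflexiveSpace.two_le_of_norm_sign_sum_lt {X : Type*} [NormedAddCommGroup X]
    [NormedSpace ℝ X] (hX : IsReflexiveSpace X) {e : ℕ → StrongDual ℝ X} (he1 : ∀ n, ‖e n‖ = 1)
    {M : ℝ} (he : ∀ ε : ℕ → ℝ, (∀ i, ε i = 1 ∨ ε i = -1) →
      ∀ n, ‖∑ i ∈ Finset.range n, ε i • e i‖ < M) : 2 ≤ M := by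
  have hM : 0 ≤ M := (norm_nonneg _).trans (he (fun _ => 1) (fun _ => Or.inl rfl) 0).le
  have hsum := sum_abs_apply_le he
  have hsummable_abs : ∀ x, Summable fun i => |e i x| := fun x =>
    summable_of_sum_range_le (fun _ => abs_nonneg _) (hsum x)
  have hsummable : ∀ x, Summable fun i => e i x := fun x => (hsummable_abs x).of_abs
  have htsum : ∀ x, ∑' i, |e i x| ≤ M * ‖x‖ := fun x =>
    Real.tsum_le_of_sum_range_le (fun _ => abs_nonneg _) (hsum x)
  obtain ⟨y, hy⟩ := exists_strongDual_apply_eq_tsum hsum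
  choose x hx1 hx using fun n => hX.exists_apply_eq_norm (e n)
  have htail : ∀ m k, m ≤ k → 2 - M ≤ (y - ∑ i ∈ Finset.range m, e i) (x k) := by
    intro m k hmk
    have h1 := (hsummable (x k)).sum_add_tsum_nat_add m
    have h2 := (hsummable_abs (x k)).sum_add_tsum_nat_add m
    have hs := (summable_nat_add_iff m).2 (hsummable (x k))
    have hs' := (summable_nat_add_iff m).2 (hsummable_abs (x k))
    have h3 := (hs.add hs').le_tsum (k - m)
      fun i _ => by linarith [neg_abs_le (e (i + m) (x k))]
    rw [hs.tsum_add hs'] at h3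
    simp only [Nat.sub_add_cancel hmk, hx, he1, abs_one] at h3
    have h4 : 0 ≤ ∑ i ∈ Finset.range m, |e i (x k)| :=
      Finset.sum_nonneg fun _ _ => abs_nonneg _
    have h5 : M * ‖x k‖ ≤ M := mul_le_of_le_one_right hM (hx1 k)
    rw [_root_.sub_apply, _root_.sum_apply, hy]
    linarith [htsum (x k)]
  obtain ⟨z, hz⟩ := hX.exists_ultrafilter_limit x hx1 (hyperfilter ℕ)
  have hzm : ∀ m, 2 - M ≤ (y - ∑ i ∈ Finset.range m, e i) z := fun m =>
    ge_of_tendsto (hz _) (Nat.hyperfilter_le_atTop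
      ((eventually_ge_atTop m).mono fun k hk => htail m k hk))
  have hlim : Tendsto (fun m => (y - ∑ i ∈ Finset.range m, e i) z) atTop (𝓝 0) := by
    simpa [hy] using
      (tendsto_const_nhds (x := y z)).sub (hsummable z).hasSum.tendsto_sum_nat
  linarith [ge_of_tendsto' hlim hzm]

theorem cpp_ell_infty_implies_finite_dim
    (X : Type*) [NormedAddCommGroup X] [NormedSpace ℝ X] [CompleteSpace X]
    (hrefl : IsReflexiveSpace X)
    (hCPP : CPP X (lp (fun _ : ℕ => ℝ) ∞)) :
    FiniteDimensional ℝ X := by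
  by_contra hfin
  obtain ⟨e, he1, he0⟩ := hrefl.exists_normalized_tendsto_zero hfin
  obtain ⟨y, hyS, hy⟩ := exists_seq_norm_sign_sum_lt (S := Set.range e) (M := 3 / 2)
    (by norm_num) fun G hG => by
      have hadd : ∀ g ∈ G, ∀ᶠ n in atTop, ‖g + e n‖ < 3 / 2 := fun g hg =>
        hCPP.eventually_norm_add_lt (fun n => (he1 n).le) he0 (hG g hg) (by norm_num)
      have hsub : ∀ g ∈ G, ∀ᶠ n in atTop, ‖g - e n‖ < 3 / 2 := fun g hg => by
        simpa [sub_eq_add_neg] using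
          hCPP.eventually_norm_add_lt (e := fun n => -e n) (fun n => by simp [he1 n])
            (fun x => by simpa using (he0 x).neg) (hG g hg) (by norm_num)
      obtain ⟨n, hn⟩ := (((Filter.eventually_all_finset G).2 hadd).and
        ((Filter.eventually_all_finset G).2 hsub)).exists
      exact ⟨e n, ⟨n, rfl⟩, fun g hg => ⟨hn.1 g hg, hn.2 g hg⟩⟩
  have hy1 : ∀ n, ‖y n‖ = 1 := fun n => by
    obtain ⟨k, hk⟩ := hyS n
    rw [← hk, he1]
  have := hrefl.two_le_of_norm_sign_sum_lt hy1 hy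
  norm_num at this
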